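/- arXiv:1411.3575 — 2 statements merged into one kernel-verified Lean document; each statement's English description precedes it below -/
import Mathlib

section
/- Let (μ,K) be an admissible pair on finite alphabets X and Y with |X| ≥ 2, and let (X,Y) ~ μ⊗K. Then the Poincaré constant of the pair, λ(μ,K) = inf{ ℰ(f(X), f(X)|Y) / Var[f(X)] : f : X → [0,∞) nonconstant }, satisfies λ(μ,K) = 1 − S(μ,K)². Equivalently, for α ≥ 1, the Poincaré inequality Var[f(X)] ≤ α·ℰ(f(X), f(X)|Y) holds for all f : X → [0,∞) if and only if η_{χ²}(μ,K) ≤ 1 − 1/α. -/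
open Finset

noncomputable section

namespace SDPI

variable {X Y : Type} [Fintype X] [Fintype Y]

def IsDist (μ : X → ℝ) : Prop := (∀ x, 0 ≤ μ x) ∧ ∑ x, μ x = 1

def IsPosDist (μ : X → ℝ) : Prop := (∀ x, 0 < μ x) ∧ ∑ x, μ x = 1

def IsChannel (K : X → Y → ℝ) : Prop :=
  (∀ x y, 0 ≤ K x y) ∧ ∀ x, ∑ y, K x y = 1

def push (μ : X → ℝ) (K : X → Y → ℝ) : Y → ℝ := fun y => ∑ x, μ x * K x y

def fDiv (Φ : ℝ → ℝ) (ν μ : X → ℝ) : ℝ := (∑ x, μ x * Φ (ν x / μ x)) - Φ 1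

def eta (Φ : ℝ → ℝ) (μ : X → ℝ) (K : X → Y → ℝ) : ℝ :=
  sSup { r | ∃ ν : X → ℝ, IsDist ν ∧ ν ≠ μ ∧
    r = fDiv Φ (push ν K) (push μ K) / fDiv Φ ν μ }

def etaSup (Φ : ℝ → ℝ) (K : X → Y → ℝ) : ℝ :=
  sSup { r | ∃ μ : X → ℝ, IsPosDist μ ∧ r = eta Φ μ K }

def maxCorr (μ : X → ℝ) (K : X → Y → ℝ) : ℝ :=
  sSup { r | ∃ (f : X → ℝ) (g : Y → ℝ),
    (∑ x, μ x * f x) = 0 ∧ (∑ y, push μ K y * g y) = 0 ∧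
    (∑ x, μ x * (f x) ^ 2) = 1 ∧ (∑ y, push μ K y * (g y) ^ 2) = 1 ∧
    r = ∑ x, ∑ y, μ x * K x y * (f x * g y) }

def adjoint (μ : X → ℝ) (K : X → Y → ℝ) : Y → X → ℝ :=
  fun y x => K x y * μ x / push μ K y

def Ent (Φ : ℝ → ℝ) (μ : X → ℝ) (f : X → ℝ) : ℝ :=
  (∑ x, μ x * Φ (f x)) - Φ (∑ x, μ x * f x)

def Var (μ : X → ℝ) (f : X → ℝ) : ℝ :=
  ∑ x, μ x * (f x - ∑ x', μ x' * f x') ^ 2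

def condExp (μ : X → ℝ) (K : X → Y → ℝ) (f : X → ℝ) : Y → ℝ :=
  fun y => (∑ x, μ x * K x y * f x) / push μ K y

def calE (μ : X → ℝ) (K : X → Y → ℝ) (f g : X → ℝ) : ℝ :=
  ∑ x, ∑ y, μ x * K x y *
    ((f x - condExp μ K f y) * (g x - condExp μ K g y))

def dirichlet (μ : X → ℝ) (M : X → X → ℝ) (f g : X → ℝ) : ℝ :=
  (1 / 2) * ∑ x, ∑ x', μ x * M x x' * ((f x - f x') * (g x - g x'))

def Homogeneous (Φ : ℝ → ℝ) : Prop :=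
  ∃ κ : ℝ → ℝ, (∀ c : ℝ, 0 < c → 0 < κ c) ∧
    ∀ (c : ℝ), 0 < c → ∀ (Z : Type) [Fintype Z], ∀ (μ : Z → ℝ),
      IsDist μ → ∀ f : Z → ℝ, (∀ z, 0 ≤ f z) →
        Ent Φ μ (fun z => c * f z) = κ c * Ent Φ μ f

def Subadditive (Φ : ℝ → ℝ) : Prop :=
  ∀ (n : ℕ) (Z : Fin n → Type) [∀ i, Fintype (Z i)],
    ∀ (μ : ∀ i, Z i → ℝ), (∀ i, IsDist (μ i)) →
    ∀ f : (∀ i, Z i) → ℝ, (∀ z, 0 ≤ f z) →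
      Ent Φ (fun z : ∀ i, Z i => ∏ i, μ i (z i)) f ≤
        ∑ i : Fin n,
          ((∑ z : ∀ j, Z j, (∏ j, μ j (z j)) * Φ (f z)) -
            ∑ z : ∀ j, Z j, (∏ j, μ j (z j)) *
              Φ (∑ w : Z i, μ i w * f (Function.update z i w)))


theorem Var_eq {μ : X → ℝ} (hμ : ∑ x, μ x = 1) (f : X → ℝ) :
    Var μ f = ∑ x, μ x * f x ^ 2 - (∑ x, μ x * f x) ^ 2 := by
  unfold Var
  set m := ∑ x, μ x * f x with hm
  have h : ∀ x, μ x * (f x - m) ^ 2 = μ x * f x ^ 2 - 2 * m * (μ x * f x) + m ^ 2 * μ x :=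
    fun x => by ring
  simp only [h, sum_add_distrib, sum_sub_distrib, ← mul_sum, hμ, ← hm]
  ring

theorem Var_affine {μ : X → ℝ} (hμ : ∑ x, μ x = 1) (a b : ℝ) (f : X → ℝ) :
    Var μ (fun x => a * f x + b) = a ^ 2 * Var μ f := by
  have h : ∑ x, μ x * (a * f x + b) = a * ∑ x, μ x * f x + b := by
    simp only [mul_add, sum_add_distrib, mul_left_comm _ a, ← mul_sum, ← sum_mul, hμ, one_mul]
  refine Eq.trans (sum_congr rfl fun x _ => ?_) (mul_sum ..).symm
  rw [h]
  ring

theorem Var_eq_zero_of_const {μ : X → ℝ} (hμ : ∑ x, μ x = 1) {f : X → ℝ}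
    (hf : ∀ x x', f x = f x') : Var μ f = 0 := by
  refine sum_eq_zero fun x _ => ?_
  simp only [hf _ x, ← sum_mul, hμ]
  ring

theorem Var_nonneg {μ : X → ℝ} (hμ : ∀ x, 0 < μ x) (f : X → ℝ) : 0 ≤ Var μ f :=
  sum_nonneg fun x _ => mul_nonneg (hμ x).le (sq_nonneg _)

theorem Var_pos {μ : X → ℝ} (hμ : ∀ x, 0 < μ x) {f : X → ℝ} {x x' : X} (h : f x ≠ f x') :
    0 < Var μ f := by
  refine (Var_nonneg hμ f).lt_of_ne fun h0 => h ?_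
  have h1 := (sum_eq_zero_iff_of_nonneg
    fun x _ => mul_nonneg (hμ x).le (sq_nonneg (f x - ∑ x', μ x' * f x'))).1 h0.symm
  have h2 : ∀ z, f z = ∑ x', μ x' * f x' := fun z => by
    have := h1 z (mem_univ z)
    simpa [(hμ z).ne', sub_eq_zero] using this
  rw [h2 x, h2 x']

theorem sum_push_mul (μ : X → ℝ) (K : X → Y → ℝ) (g : Y → ℝ) :
    ∑ y, push μ K y * g y = ∑ x, ∑ y, μ x * K x y * g y := by
  rw [sum_comm]
  exact sum_congr rfl fun y _ => sum_mul ..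

theorem sum_sum_channel {μ : X → ℝ} {K : X → Y → ℝ} (hK : IsChannel K) (f : X → ℝ) :
    ∑ x, ∑ y, μ x * K x y * f x = ∑ x, μ x * f x :=
  sum_congr rfl fun x _ => by rw [← sum_mul, ← mul_sum, hK.2, mul_one]

theorem sum_push {μ : X → ℝ} {K : X → Y → ℝ} (hK : IsChannel K) :
    ∑ y, push μ K y = ∑ x, μ x := by
  simpa [sum_sum_channel hK] using (sum_push_mul μ K 1).trans (sum_sum_channel hK 1)

theorem push_mul_condExp {X Y : Type} [Fintype X] {μ : X → ℝ} {K : X → Y → ℝ}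
    (hadm : ∀ y, 0 < push μ K y) (f : X → ℝ) (y : Y) :
    push μ K y * condExp μ K f y = ∑ x, μ x * K x y * f x :=
  mul_div_cancel₀ _ (hadm y).ne'

theorem sum_push_mul_condExp_mul {μ : X → ℝ} {K : X → Y → ℝ} (hadm : ∀ y, 0 < push μ K y)
    (f : X → ℝ) (g : Y → ℝ) :
    ∑ y, push μ K y * (condExp μ K f y * g y) = ∑ x, ∑ y, μ x * K x y * (f x * g y) := by
  rw [sum_comm]
  refine sum_congr rfl fun y _ => ?_
  rw [← mul_assoc, push_mul_condExp hadm, sum_mul]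
  exact sum_congr rfl fun x _ => by ring

theorem sum_push_mul_condExp {μ : X → ℝ} {K : X → Y → ℝ} (hK : IsChannel K)
    (hadm : ∀ y, 0 < push μ K y) (f : X → ℝ) :
    ∑ y, push μ K y * condExp μ K f y = ∑ x, μ x * f x := by
  simpa [sum_sum_channel hK] using sum_push_mul_condExp_mul hadm f 1

theorem condExp_affine {X Y : Type} [Fintype X] {μ : X → ℝ} {K : X → Y → ℝ}
    (hadm : ∀ y, 0 < push μ K y) (a b : ℝ) (f : X → ℝ) :
    condExp μ K (fun x => a * f x + b) = fun y => a * condExp μ K f y + b := by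
  funext y
  apply mul_left_cancel₀ (hadm y).ne'
  rw [push_mul_condExp hadm, mul_add, mul_left_comm, push_mul_condExp hadm, mul_sum]
  unfold push
  rw [sum_mul, ← sum_add_distrib]
  exact sum_congr rfl fun x _ => by ring

/-- The law of total variance. -/
theorem calE_eq_Var_sub {μ : X → ℝ} {K : X → Y → ℝ} (hμ : ∑ x, μ x = 1) (hK : IsChannel K)
    (hadm : ∀ y, 0 < push μ K y) (f : X → ℝ) :
    calE μ K f f = Var μ f - Var (push μ K) (condExp μ K f) := by
  rw [Var_eq hμ, Var_eq ((sum_push hK).trans hμ), sum_push_mul_condExp hK hadm]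
  have h1 := sum_push_mul_condExp_mul hadm f (condExp μ K f)
  have h2 := sum_push_mul μ K fun y => condExp μ K f y ^ 2
  have h3 := sum_sum_channel (μ := μ) hK fun x => f x ^ 2
  have h : ∀ x y, μ x * K x y * ((f x - condExp μ K f y) * (f x - condExp μ K f y)) =
      μ x * K x y * f x ^ 2 - 2 * (μ x * K x y * (f x * condExp μ K f y)) +
        μ x * K x y * condExp μ K f y ^ 2 := fun x y => by ring
  simp only [calE, h, sum_add_distrib, sum_sub_distrib, ← mul_sum] at h3 ⊢
  rw [← h1, ← h2, h3]
  simp only [← sq]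
  ring

theorem calE_self_nonneg {μ : X → ℝ} {K : X → Y → ℝ} (hμ : ∀ x, 0 < μ x) (hK : IsChannel K)
    (f : X → ℝ) : 0 ≤ calE μ K f f :=
  sum_nonneg fun x _ => sum_nonneg fun y _ =>
    mul_nonneg (mul_nonneg (hμ x).le (hK.1 x y)) (mul_self_nonneg _)

/-- The operator `f ↦ E[f(X)|Y]` contracts variances by the factor `c`. -/
def Contracts (μ : X → ℝ) (K : X → Y → ℝ) (c : ℝ) : Prop :=
  ∀ f : X → ℝ, Var (push μ K) (condExp μ K f) ≤ c * Var μ f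

theorem contracts_one {μ : X → ℝ} {K : X → Y → ℝ} (hμ : IsPosDist μ) (hK : IsChannel K)
    (hadm : ∀ y, 0 < push μ K y) : Contracts μ K 1 := fun f => by
  have := calE_self_nonneg hμ.1 hK f
  rw [calE_eq_Var_sub hμ.2 hK hadm] at this
  linarith

theorem contracts_of_nonneg {μ : X → ℝ} {K : X → Y → ℝ} (hμ : IsPosDist μ) (hK : IsChannel K)
    (hadm : ∀ y, 0 < push μ K y)
    {c : ℝ}
    (h : ∀ f : X → ℝ, (∀ x, 0 ≤ f x) → Var (push μ K) (condExp μ K f) ≤ c * Var μ f) :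
    Contracts μ K c := fun f => by
  have h1 := h (fun x => 1 * f x + ∑ z, |f z|) fun x => by
    have := single_le_sum (f := fun z => |f z|) (fun z _ => abs_nonneg (f z)) (mem_univ x)
    have := neg_abs_le (f x)
    linarith
  rwa [condExp_affine hadm, Var_affine hμ.2, Var_affine ((sum_push hK).trans hμ.2), one_pow,
    one_mul, one_mul] at h1

theorem correlation_le_sqrt {μ : X → ℝ} {K : X → Y → ℝ} (hμ : IsPosDist μ) (hK : IsChannel K)
    (hadm : ∀ y, 0 < push μ K y)
    {c : ℝ} (hc : Contracts μ K c) {f : X → ℝ} {g : Y → ℝ}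
    (hf : ∑ x, μ x * f x = 0) (hf2 : ∑ x, μ x * f x ^ 2 = 1)
    (hg2 : ∑ y, push μ K y * g y ^ 2 = 1) :
    ∑ x, ∑ y, μ x * K x y * (f x * g y) ≤ √c := by
  rw [← sum_push_mul_condExp_mul hadm]
  apply Real.le_sqrt_of_sq_le
  have hcf := hc f
  rw [Var_eq hμ.2, Var_eq ((sum_push hK).trans hμ.2), sum_push_mul_condExp hK hadm, hf, hf2]
    at hcf
  have hcs := sum_sq_le_sum_mul_sum_of_sq_le_mul univ
    (r := fun y => push μ K y * (condExp μ K f y * g y))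
    (f := fun y => push μ K y * condExp μ K f y ^ 2) (g := fun y => push μ K y * g y ^ 2)
    (fun y _ => mul_nonneg (hadm y).le (sq_nonneg _))
    (fun y _ => mul_nonneg (hadm y).le (sq_nonneg _)) (fun y _ => le_of_eq (by ring))
  rw [hg2] at hcs
  linarith

theorem maxCorr_nonneg {μ : X → ℝ} {K : X → Y → ℝ} (hμ : IsPosDist μ) (hK : IsChannel K)
    (hadm : ∀ y, 0 < push μ K y) : 0 ≤ maxCorr μ K := by
  have hbdd : BddAbove { r | ∃ (f : X → ℝ) (g : Y → ℝ),
      (∑ x, μ x * f x) = 0 ∧ (∑ y, push μ K y * g y) = 0 ∧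
      (∑ x, μ x * (f x) ^ 2) = 1 ∧ (∑ y, push μ K y * (g y) ^ 2) = 1 ∧
      r = ∑ x, ∑ y, μ x * K x y * (f x * g y) } := by
    refine ⟨√1, ?_⟩
    rintro _ ⟨f, g, hf, -, hf2, hg2, rfl⟩
    exact correlation_le_sqrt hμ hK hadm (contracts_one hμ hK hadm) hf hf2 hg2
  by_cases hne : ∃ (f : X → ℝ) (g : Y → ℝ),
      (∑ x, μ x * f x) = 0 ∧ (∑ y, push μ K y * g y) = 0 ∧
      (∑ x, μ x * (f x) ^ 2) = 1 ∧ (∑ y, push μ K y * (g y) ^ 2) = 1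
  · obtain ⟨f, g, hf, hg, hf2, hg2⟩ := hne
    have h1 := le_csSup hbdd ⟨f, g, hf, hg, hf2, hg2, rfl⟩
    have h2 := le_csSup hbdd ⟨f, fun y => -g y, hf, by simp [hg], hf2, by simp [hg2], rfl⟩
    simp only [mul_neg, sum_neg_distrib] at h2
    unfold maxCorr
    linarith
  · refine Real.sSup_nonneg fun r hr => ?_
    obtain ⟨f, g, hf, hg, hf2, hg2, -⟩ := hr
    exact absurd ⟨f, g, hf, hg, hf2, hg2⟩ hne

theorem contracts_maxCorr_sq {μ : X → ℝ} {K : X → Y → ℝ} (hμ : IsPosDist μ) (hK : IsChannel K)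
    (hadm : ∀ y, 0 < push μ K y) : Contracts μ K (maxCorr μ K ^ 2) := fun f => by
  set w := Var (push μ K) (condExp μ K f) with hw
  set v := Var μ f
  have hν := (sum_push hK).trans hμ.2
  have hvw : w ≤ v := by simpa using contracts_one hμ hK hadm f
  rcases (Var_nonneg hadm (condExp μ K f)).eq_or_lt with h0 | hwpos
  · rw [hw, ← h0]
    exact mul_nonneg (sq_nonneg _) (Var_nonneg hμ.1 f)
  have hvpos : 0 < v := hwpos.trans_le hvw
  rw [← hw] at hwpos
  set m := ∑ x, μ x * f x with hm
  have hmT : ∑ y, push μ K y * condExp μ K f y = m := sum_push_mul_condExp hK hadm f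
  have hsv := Real.sq_sqrt hvpos.le
  have hsw := Real.sq_sqrt hwpos.le
  have hf0 : ∑ x, μ x * (f x - m) = 0 := by
    simp only [mul_sub, sum_sub_distrib, ← sum_mul, hμ.2, ← hm]
    ring
  have hg0 : ∑ y, push μ K y * (condExp μ K f y - m) = 0 := by
    simp only [mul_sub, sum_sub_distrib, ← sum_mul, hν, hmT]
    ring
  have hf2 : ∑ x, μ x * (f x - m) ^ 2 = v := rfl
  have hg2 : ∑ y, push μ K y * (condExp μ K f y - m) ^ 2 = w := by rw [hw, Var, hmT]
  have hfg : ∑ x, ∑ y, μ x * K x y * ((f x - m) * (condExp μ K f y - m)) = w := by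
    rw [← sum_push_mul_condExp_mul hadm (fun x => f x - m)]
    have := condExp_affine hadm 1 (-m) f
    simp only [one_mul, ← sub_eq_add_neg] at this
    rw [this, ← hg2]
    simp only [sq]
  have hle : w / (√v * √w) ≤ maxCorr μ K := by
    refine le_csSup ⟨√1, ?_⟩
      ⟨fun x => (f x - m) / √v, fun y => (condExp μ K f y - m) / √w, ?_, ?_, ?_, ?_, ?_⟩
    · rintro _ ⟨f, g, hf, -, hf2, hg2, rfl⟩
      exact correlation_le_sqrt hμ hK hadm (contracts_one hμ hK hadm) hf hf2 hg2
    · simp only [← mul_div_assoc, ← sum_div, hf0, zero_div]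
    · simp only [← mul_div_assoc, ← sum_div, hg0, zero_div]
    · simp only [div_pow, ← mul_div_assoc, ← sum_div, hf2, hsv, div_self hvpos.ne']
    · simp only [div_pow, ← mul_div_assoc, ← sum_div, hg2, hsw, div_self hwpos.ne']
    · simp only [div_mul_div_comm (_ - m), ← mul_div_assoc, ← sum_div, hfg]
  have hsq := pow_le_pow_left₀ (by positivity) hle 2
  rw [div_pow, mul_pow, hsv, hsw, div_le_iff₀ (by positivity)] at hsq
  refine le_of_mul_le_mul_right ?_ hwpos
  linarith

theorem contracts_iff_maxCorr {μ : X → ℝ} {K : X → Y → ℝ} (hμ : IsPosDist μ) (hK : IsChannel K)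
    (hadm : ∀ y, 0 < push μ K y)
    {c : ℝ} (hc : 0 ≤ c) :
    Contracts μ K c ↔ maxCorr μ K ^ 2 ≤ c := by
  refine ⟨fun h => ?_, fun h f => (contracts_maxCorr_sq hμ hK hadm f).trans
    (mul_le_mul_of_nonneg_right h (Var_nonneg hμ.1 f))⟩
  rw [← Real.le_sqrt (maxCorr_nonneg hμ hK hadm) hc]
  refine Real.sSup_le ?_ (Real.sqrt_nonneg c)
  rintro _ ⟨f, g, hf, -, hf2, hg2, rfl⟩
  exact correlation_le_sqrt hμ hK hadm h hf hf2 hg2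

theorem fDiv_sq_mul_eq_Var {μ : X → ℝ} {K : X → Y → ℝ} (hμ : IsPosDist μ) (hK : IsChannel K)
    (hadm : ∀ y, 0 < push μ K y)
    {f : X → ℝ} (hf : ∑ x, μ x * f x = 1) :
    fDiv (fun u => (u - 1) ^ 2) (fun x => μ x * f x) μ = Var μ f ∧
      fDiv (fun u => (u - 1) ^ 2) (push (fun x => μ x * f x) K) (push μ K) =
        Var (push μ K) (condExp μ K f) := by
  constructor
  · simp [fDiv, Var, hf, fun x => mul_div_cancel_left₀ (f x) (hμ.1 x).ne']
  · have : ∀ y, push (fun x => μ x * f x) K y / push μ K y = condExp μ K f y := fun y =>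
      congrArg (· / push μ K y) (sum_congr rfl fun x _ => mul_right_comm ..)
    simp [fDiv, Var, this, sum_push_mul_condExp hK hadm, hf]

theorem ratio_le_of_contracts {μ : X → ℝ} {K : X → Y → ℝ} (hμ : IsPosDist μ) (hK : IsChannel K)
    (hadm : ∀ y, 0 < push μ K y)
    {c : ℝ} (hc : 0 ≤ c) (h : Contracts μ K c) {ν : X → ℝ}
    (hν : IsDist ν) :
    fDiv (fun u => (u - 1) ^ 2) (push ν K) (push μ K) / fDiv (fun u => (u - 1) ^ 2) ν μ ≤ c := by
  have hνμ : ν = fun x => μ x * (ν x / μ x) := by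
    funext x
    rw [mul_div_cancel₀ _ (hμ.1 x).ne']
  have hsum : ∑ x, μ x * (ν x / μ x) = 1 := by rw [← hν.2, hνμ.symm.subst rfl]
  obtain ⟨h1, h2⟩ := fDiv_sq_mul_eq_Var hμ hK hadm hsum
  rw [← hνμ] at h1 h2
  rw [h1, h2]
  exact div_le_of_le_mul₀ (Var_nonneg hμ.1 _) hc (h _)

theorem contracts_iff_eta {μ : X → ℝ} {K : X → Y → ℝ} (hμ : IsPosDist μ) (hK : IsChannel K)
    (hadm : ∀ y, 0 < push μ K y)
    {c : ℝ} (hc : 0 ≤ c) :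
    Contracts μ K c ↔ eta (fun u => (u - 1) ^ 2) μ K ≤ c := by
  constructor
  · intro h
    refine Real.sSup_le ?_ hc
    rintro _ ⟨ν, hν, -, rfl⟩
    exact ratio_le_of_contracts hμ hK hadm hc h hν
  intro h
  refine contracts_of_nonneg hμ hK hadm fun f hf0 => ?_
  by_cases hconst : ∃ x x', f x ≠ f x'
  swap
  · push Not at hconst
    simpa [Var_eq_zero_of_const hμ.2 hconst] using contracts_one hμ hK hadm f
  obtain ⟨x, x', hxx⟩ := hconst
  set m := ∑ x, μ x * f x with hm
  have hmpos : 0 < m := by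
    refine (sum_nonneg fun x _ => mul_nonneg (hμ.1 x).le (hf0 x)).lt_of_ne fun h0 => hxx ?_
    have h1 := (sum_eq_zero_iff_of_nonneg
      fun x _ => mul_nonneg (hμ.1 x).le (hf0 x)).1 h0.symm
    have h2 : ∀ z, f z = 0 := fun z => by simpa [(hμ.1 z).ne'] using h1 z (mem_univ z)
    rw [h2 x, h2 x']
  set g : X → ℝ := fun x => m⁻¹ * f x + 0 with hg
  have hg1 : ∑ x, μ x * g x = 1 := by
    simp only [hg, add_zero, mul_left_comm _ m⁻¹, ← mul_sum, ← hm]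
    exact inv_mul_cancel₀ hmpos.ne'
  have hgne : g x ≠ g x' := by simpa [hg, hmpos.ne'] using hxx
  have hle : Var (push μ K) (condExp μ K g) / Var μ g ≤ c := by
    refine h.trans' (le_csSup ⟨1, ?_⟩
      ⟨fun x => μ x * g x, ⟨fun x => ?_, hg1⟩, fun heq => hgne ?_, ?_⟩)
    · rintro _ ⟨ν, hν, -, rfl⟩
      exact ratio_le_of_contracts hμ hK hadm zero_le_one (contracts_one hμ hK hadm) hν
    · have := (hμ.1 x).le
      have := hf0 x
      simp only [hg]
      positivity
    · have h1 : ∀ z, g z = 1 := fun z => by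
        simpa [(hμ.1 z).ne'] using congrFun heq z
      rw [h1, h1]
    · obtain ⟨h1, h2⟩ := fDiv_sq_mul_eq_Var hμ hK hadm hg1
      rw [h1, h2]
  rw [div_le_iff₀ (Var_pos hμ.1 hgne), hg, condExp_affine hadm, Var_affine hμ.2,
    Var_affine ((sum_push hK).trans hμ.2), mul_left_comm] at hle
  exact le_of_mul_le_mul_left hle (by positivity)

/-- Theorem (Poincaré constant equals one minus squared maximal correlation): for an
admissible pair `(μ,K)` with `|X| ≥ 2`,
`λ(μ,K) = inf{ℰ(f(X),f(X)|Y)/Var[f(X)] : f nonconstant, f ≥ 0} = 1 − S(μ,K)²`;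
equivalently, for `α ≥ 1` the Poincaré inequality `Var[f(X)] ≤ α·ℰ(f(X),f(X)|Y)`
holds for all `f ≥ 0` iff `η_{χ²}(μ,K) ≤ 1 − 1/α`. -/
theorem statement14 {X Y : Type} [Fintype X] [Fintype Y] [Nonempty X] [Nonempty Y]
    (hX : 2 ≤ Fintype.card X)
    (μ : X → ℝ) (K : X → Y → ℝ) (hμ : IsPosDist μ) (hK : IsChannel K)
    (hadm : ∀ y, 0 < push μ K y) :
    sInf { r | ∃ f : X → ℝ, (∀ x, 0 ≤ f x) ∧ (∃ x x', f x ≠ f x') ∧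
        r = calE μ K f f / Var μ f } = 1 - (maxCorr μ K) ^ 2 ∧
    ∀ α : ℝ, 1 ≤ α →
      ((∀ f : X → ℝ, (∀ x, 0 ≤ f x) → Var μ f ≤ α * calE μ K f f) ↔
        eta (fun u => (u - 1) ^ 2) μ K ≤ 1 - 1 / α) := by
  have hcalE := calE_eq_Var_sub hμ.2 hK hadm
  constructor
  · have : Nontrivial X := Fintype.one_lt_card_iff_nontrivial.1 hX
    obtain ⟨a, b, hab⟩ := exists_pair_ne X
    classical
    have hne : { r | ∃ f : X → ℝ, (∀ x, 0 ≤ f x) ∧ (∃ x x', f x ≠ f x') ∧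
        r = calE μ K f f / Var μ f }.Nonempty :=
      ⟨_, Pi.single a 1, fun x => by by_cases h : x = a <;> simp [h],
        ⟨a, b, by simp [hab.symm]⟩, rfl⟩
    refine IsGLB.csInf_eq ⟨?_, fun r hr => ?_⟩ hne
    · rintro _ ⟨f, -, ⟨x, x', hf⟩, rfl⟩
      rw [le_div_iff₀ (Var_pos hμ.1 hf), hcalE]
      linarith [contracts_maxCorr_sq hμ hK hadm f]
    · have hr' : ∀ f : X → ℝ, (∀ x, 0 ≤ f x) → (∃ x x', f x ≠ f x') →
          Var (push μ K) (condExp μ K f) ≤ (1 - r) * Var μ f := by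
        rintro f hf0 ⟨x, x', hf⟩
        have := hr ⟨f, hf0, ⟨x, x', hf⟩, rfl⟩
        rw [le_div_iff₀ (Var_pos hμ.1 hf), hcalE] at this
        linarith
      have hr1 : 0 ≤ 1 - r := by
        obtain ⟨_, f, hf0, ⟨x, x', hf⟩, -⟩ := hne
        exact nonneg_of_mul_nonneg_left
          ((Var_nonneg hadm _).trans (hr' f hf0 ⟨x, x', hf⟩)) (Var_pos hμ.1 hf)
      have := (contracts_iff_maxCorr hμ hK hadm hr1).1 <|
        contracts_of_nonneg hμ hK hadm fun f hf0 => by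
          by_cases hf : ∃ x x', f x ≠ f x'
          · exact hr' f hf0 hf
          · rw [Var_eq_zero_of_const hμ.2 (by simpa using hf), mul_zero]
            simpa [Var_eq_zero_of_const hμ.2 (f := f) (by simpa using hf)]
              using contracts_one hμ hK hadm f
      linarith
  · intro α hα
    have hα0 : 0 < α := by linarith
    rw [← contracts_iff_eta hμ hK hadm (by rw [sub_nonneg]; exact (div_le_one hα0).2 hα)]
    have key : ∀ f, Var μ f ≤ α * calE μ K f f ↔
        Var (push μ K) (condExp μ K f) ≤ (1 - 1 / α) * Var μ f := fun f => by
      rw [hcalE, ← div_le_iff₀' hα0, sub_mul, one_mul, one_div_mul_eq_div]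
      constructor <;> intro <;> linarith
    simp only [key]
    exact ⟨contracts_of_nonneg hμ hK hadm, fun h f _ => h f⟩

end SDPI
end
end

section
/- Let μ be a strictly positive probability distribution on a finite set X, and let M be a channel from X to X reversible with respect to μ. Define the log-Sobolev constant of order 2, ρ̃₂(μ,M) = inf{ ℰ_{μ,M}(f,f)/Ent[f(X)²] : f : X → (0,∞) with Ent[f(X)²] > 0 }, where X ~ μ. Then for every channel K from X to a finite set Y such that (μ,K) is admissible and (μ,M) factors through K: η(μ,K) ≤ 1 − ρ̃₂(μ,M). -/
open Finset

noncomputable section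

namespace SDPI

variable {X Y : Type} [Fintype X] [Fintype Y]

/-- The log-Sobolev constant of order 2 of a reversible pair `(μ,M)`:
`ρ̃₂(μ,M) = inf{ ℰ_{μ,M}(f,f)/Ent[f(X)²] : f : X → (0,∞), Ent[f(X)²] > 0 }`. -/
def rho2tilde {X : Type} [Fintype X] (μ : X → ℝ) (M : X → X → ℝ) : ℝ :=
  sInf { r | ∃ f : X → ℝ, (∀ x, 0 < f x) ∧
    0 < Ent (fun u => u * Real.log u) μ (fun x => (f x) ^ 2) ∧
    r = dirichlet μ M f f / Ent (fun u => u * Real.log u) μ (fun x => (f x) ^ 2) }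

/-- The entropy functional of the square of a nonnegative function dominates its variance. -/
lemma variance_le_ent_sq {w f : X → ℝ} (hw : IsDist w) (hf : ∀ x, 0 ≤ f x) :
    (∑ x, w x * f x ^ 2) - (∑ x, w x * f x) ^ 2
      ≤ Ent (fun u => u * Real.log u) w (fun x => f x ^ 2) := by
  unfold Ent
  set m := ∑ x, w x * f x ^ 2 with hm
  have hm0 : 0 ≤ m := Finset.sum_nonneg fun x _ => mul_nonneg (hw.1 x) (sq_nonneg _)
  have hss : Real.sqrt m ^ 2 = m := Real.sq_sqrt hm0
  rcases hm0.eq_or_lt with h0 | hpos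
  · have hz : ∀ x, w x * f x ^ 2 = 0 := fun x =>
      (Finset.sum_eq_zero_iff_of_nonneg
        (fun x _ => mul_nonneg (hw.1 x) (sq_nonneg _))).1 (hm ▸ h0.symm) x (Finset.mem_univ x)
    have hsum : ∑ x, w x * (f x ^ 2 * Real.log (f x ^ 2)) = 0 :=
      Finset.sum_eq_zero fun x _ => by rw [← mul_assoc, hz x, zero_mul]
    rw [hsum, ← h0]
    simp only [zero_mul]
    nlinarith [sq_nonneg (∑ x, w x * f x)]
  · set s := Real.sqrt m with hs
    have hspos : 0 < s := Real.sqrt_pos.2 hpos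
    have key : ∀ x, w x * (2 * f x ^ 2 - 2 * s * f x)
        ≤ w x * (f x ^ 2 * Real.log (f x ^ 2)) - w x * f x ^ 2 * Real.log m := by
      intro x
      rw [mul_assoc (w x), ← mul_sub]
      refine mul_le_mul_of_nonneg_left ?_ (hw.1 x)
      rcases (hf x).eq_or_lt with h | h
      · simp [← h]
      · have hl := Real.one_sub_inv_le_log_of_pos (div_pos h hspos)
        rw [Real.log_div h.ne' hspos.ne', inv_div] at hl
        have hmul := mul_le_mul_of_nonneg_left hl (by positivity : 0 ≤ 2 * f x ^ 2)
        have heq : 2 * f x ^ 2 * (1 - s / f x) = 2 * f x ^ 2 - 2 * s * f x := by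
          field_simp
        rw [heq] at hmul
        rw [← hss, Real.log_pow, Real.log_pow]
        push_cast
        linarith
    have hsum := Finset.sum_le_sum fun x (_ : x ∈ Finset.univ) => key x
    have e1 : ∑ x, w x * (2 * f x ^ 2 - 2 * s * f x) = 2 * m - 2 * s * ∑ x, w x * f x := by
      rw [hm, Finset.mul_sum, Finset.mul_sum, ← Finset.sum_sub_distrib]
      exact Finset.sum_congr rfl fun x _ => by ring
    rw [e1, Finset.sum_sub_distrib, ← Finset.sum_mul, ← hm] at hsum
    nlinarith [sq_nonneg (s - ∑ x, w x * f x)]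

lemma ent_sq_nonneg {w f : X → ℝ} (hw : IsDist w) (hf : ∀ x, 0 ≤ f x) :
    0 ≤ Ent (fun u => u * Real.log u) w (fun x => f x ^ 2) := by
  refine le_trans ?_ (variance_le_ent_sq hw hf)
  have h := Finset.sum_nonneg fun x (_ : x ∈ Finset.univ) =>
    mul_nonneg (hw.1 x) (sq_nonneg (f x - ∑ x', w x' * f x'))
  have e : ∑ x, w x * (f x - ∑ x', w x' * f x') ^ 2
      = (∑ x, w x * f x ^ 2) - (∑ x, w x * f x) ^ 2 := by
    set a := ∑ x', w x' * f x' with ha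
    have : ∀ x, w x * (f x - a) ^ 2 = w x * f x ^ 2 - 2 * a * (w x * f x) + a ^ 2 * w x :=
      fun x => by ring
    simp_rw [this]
    rw [Finset.sum_add_distrib, Finset.sum_sub_distrib, ← Finset.mul_sum, ← Finset.mul_sum,
      hw.2, ← ha]
    ring
  linarith

lemma push_isDist {μ : X → ℝ} {K : X → Y → ℝ} (hμ : IsDist μ) (hK : IsChannel K) :
    IsDist (push μ K) := by
  refine ⟨fun y => Finset.sum_nonneg fun x _ => mul_nonneg (hμ.1 x) (hK.1 x y), ?_⟩
  unfold push
  rw [Finset.sum_comm]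
  simp_rw [← Finset.mul_sum, hK.2, mul_one]
  exact hμ.2

lemma adjoint_isDist {μ : X → ℝ} {K : X → Y → ℝ} (hμ : IsDist μ) (hK : IsChannel K)
    {y : Y} (hy : 0 < push μ K y) : IsDist (adjoint μ K y) := by
  refine ⟨fun x => div_nonneg (mul_nonneg (hK.1 x y) (hμ.1 x)) hy.le, ?_⟩
  unfold adjoint
  rw [← Finset.sum_div, div_eq_one_iff_eq hy.ne']
  exact Finset.sum_congr rfl fun x _ => mul_comm _ _

lemma push_mul_adjoint {Y : Type} {μ : X → ℝ} {K : X → Y → ℝ} {y : Y} (hy : 0 < push μ K y) (x : X) :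
    push μ K y * adjoint μ K y x = μ x * K x y := by
  unfold adjoint
  field_simp

lemma sum_push_adjoint {μ : X → ℝ} {K : X → Y → ℝ} (hK : IsChannel K)
    (hadm : ∀ y, 0 < push μ K y) (F : X → ℝ) :
    ∑ y, push μ K y * ∑ x, adjoint μ K y x * F x = ∑ x, μ x * F x := by
  simp_rw [Finset.mul_sum, ← mul_assoc, push_mul_adjoint (hadm _)]
  rw [Finset.sum_comm]
  refine Finset.sum_congr rfl fun x _ => ?_
  rw [← Finset.sum_mul, ← Finset.mul_sum, hK.2, mul_one]

lemma dirichlet_self_eq {μ : X → ℝ} {M : X → X → ℝ} (hM : IsChannel M)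
    (hrev : ∀ x x', μ x * M x x' = μ x' * M x' x) (f : X → ℝ) :
    dirichlet μ M f f = (∑ x, μ x * f x ^ 2) - ∑ x, ∑ x', μ x * M x x' * (f x * f x') := by
  unfold dirichlet
  have h1 : ∑ x, ∑ x', μ x * M x x' * f x ^ 2 = ∑ x, μ x * f x ^ 2 := by
    refine Finset.sum_congr rfl fun x _ => ?_
    rw [← Finset.sum_mul, ← Finset.mul_sum, hM.2, mul_one]
  have h2 : ∑ x, ∑ x', μ x * M x x' * f x' ^ 2 = ∑ x, μ x * f x ^ 2 := by
    rw [Finset.sum_comm, ← h1]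
    exact Finset.sum_congr rfl fun x _ => Finset.sum_congr rfl fun x' _ => by rw [hrev]
  have h3 : ∀ x x', μ x * M x x' * ((f x - f x') * (f x - f x'))
      = μ x * M x x' * f x ^ 2 + μ x * M x x' * f x' ^ 2
        - 2 * (μ x * M x x' * (f x * f x')) := fun x x' => by ring
  simp_rw [h3, Finset.sum_sub_distrib, Finset.sum_add_distrib, ← Finset.mul_sum]
  rw [h1, h2]
  ring

lemma dirichlet_self_nonneg {μ : X → ℝ} {M : X → X → ℝ} (hμ : IsDist μ) (hM : IsChannel M)
    (f : X → ℝ) : 0 ≤ dirichlet μ M f f :=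
  mul_nonneg (by norm_num) <| Finset.sum_nonneg fun x _ => Finset.sum_nonneg fun x' _ =>
    mul_nonneg (mul_nonneg (hμ.1 x) (hM.1 x x')) (mul_self_nonneg _)

lemma sum_mul_factored {μ : X → ℝ} {M : X → X → ℝ} {K : X → Y → ℝ}
    (hadm : ∀ y, 0 < push μ K y)
    (hfact : ∀ x x', M x x' = ∑ y, adjoint μ K y x' * K x y) (f : X → ℝ) :
    ∑ x, ∑ x', μ x * M x x' * (f x * f x')
      = ∑ y, push μ K y * (∑ x, adjoint μ K y x * f x) ^ 2 := by
  have hr : ∀ y, push μ K y * (∑ x, adjoint μ K y x * f x) ^ 2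
      = ∑ x, ∑ x', μ x * K x y * f x * (adjoint μ K y x' * f x') := by
    intro y
    rw [sq, ← mul_assoc, Finset.mul_sum _ (fun x => adjoint μ K y x * f x) (push μ K y),
      Finset.sum_mul_sum]
    simp_rw [← mul_assoc, push_mul_adjoint (hadm y)]
  simp_rw [hr]
  conv_rhs => rw [Finset.sum_comm]
  refine Finset.sum_congr rfl fun x _ => ?_
  conv_rhs => rw [Finset.sum_comm]
  refine Finset.sum_congr rfl fun x' _ => ?_
  rw [hfact, Finset.mul_sum, Finset.sum_mul]
  exact Finset.sum_congr rfl fun y _ => by ring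

/-- The entropy lost by conditioning on the output of a factor `K` of `M` dominates the
Dirichlet form of `M`. -/
lemma dirichlet_add_ent_le_ent {μ : X → ℝ} {M : X → X → ℝ} {K : X → Y → ℝ} (hμ : IsDist μ)
    (hM : IsChannel M) (hrev : ∀ x x', μ x * M x x' = μ x' * M x' x) (hK : IsChannel K)
    (hadm : ∀ y, 0 < push μ K y)
    (hfact : ∀ x x', M x x' = ∑ y, adjoint μ K y x' * K x y)
    {f : X → ℝ} (hf : ∀ x, 0 ≤ f x) :
    dirichlet μ M f f
        + Ent (fun u => u * Real.log u) (push μ K) (fun y => ∑ x, adjoint μ K y x * f x ^ 2)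
      ≤ Ent (fun u => u * Real.log u) μ (fun x => f x ^ 2) := by
  have h := Finset.sum_le_sum fun y (_ : y ∈ Finset.univ) =>
    mul_le_mul_of_nonneg_left
      (variance_le_ent_sq (adjoint_isDist hμ hK (hadm y)) hf) (hadm y).le
  unfold Ent at h ⊢
  simp_rw [mul_sub, Finset.sum_sub_distrib] at h
  rw [sum_push_adjoint hK hadm, sum_push_adjoint hK hadm,
    ← sum_mul_factored hadm hfact, ← dirichlet_self_eq hM hrev] at h
  rw [sum_push_adjoint hK hadm]
  linarith

lemma rho2tilde_nonneg {μ : X → ℝ} {M : X → X → ℝ} (hμ : IsDist μ) (hM : IsChannel M) :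
    0 ≤ rho2tilde μ M := by
  refine Real.sInf_nonneg ?_
  rintro r ⟨f, -, hf, rfl⟩
  exact div_nonneg (dirichlet_self_nonneg hμ hM f) hf.le

lemma rho2tilde_le {μ : X → ℝ} {M : X → X → ℝ} (hμ : IsDist μ) (hM : IsChannel M)
    {f : X → ℝ} (hf : ∀ x, 0 < f x)
    (hE : 0 < Ent (fun u => u * Real.log u) μ (fun x => f x ^ 2)) :
    rho2tilde μ M
      ≤ dirichlet μ M f f / Ent (fun u => u * Real.log u) μ (fun x => f x ^ 2) := by
  refine csInf_le ⟨0, ?_⟩ ⟨f, hf, hE, rfl⟩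
  rintro r ⟨g, -, hg, rfl⟩
  exact div_nonneg (dirichlet_self_nonneg hμ hM g) hg.le

lemma rho2tilde_mul_ent_le_of_pos {μ : X → ℝ} {M : X → X → ℝ} (hμ : IsDist μ)
    (hM : IsChannel M) {f : X → ℝ} (hf : ∀ x, 0 < f x) :
    rho2tilde μ M * Ent (fun u => u * Real.log u) μ (fun x => f x ^ 2)
      ≤ dirichlet μ M f f := by
  rcases le_or_gt (Ent (fun u => u * Real.log u) μ (fun x => f x ^ 2)) 0 with h | h
  · exact (mul_nonpos_of_nonneg_of_nonpos (rho2tilde_nonneg hμ hM) h).trans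
      (dirichlet_self_nonneg hμ hM f)
  · exact (le_div_iff₀ h).1 (rho2tilde_le hμ hM hf h)

lemma rho2tilde_mul_ent_le {μ : X → ℝ} {M : X → X → ℝ} (hμ : IsDist μ)
    (hM : IsChannel M) {f : X → ℝ} (hf : ∀ x, 0 ≤ f x) :
    rho2tilde μ M * Ent (fun u => u * Real.log u) μ (fun x => f x ^ 2)
      ≤ dirichlet μ M f f := by
  have hc : Continuous fun ε : ℝ => dirichlet μ M (fun x => f x + ε) (fun x => f x + ε)
      - rho2tilde μ M * Ent (fun u => u * Real.log u) μ (fun x => (f x + ε) ^ 2) := by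
    have hlog := Real.continuous_mul_log
    have h1 : ∀ x, Continuous fun ε : ℝ => (f x + ε) ^ 2 * Real.log ((f x + ε) ^ 2) :=
      fun x => hlog.comp (by fun_prop : Continuous fun ε : ℝ => (f x + ε) ^ 2)
    have h2 : Continuous fun ε : ℝ => (∑ x, μ x * (f x + ε) ^ 2)
        * Real.log (∑ x, μ x * (f x + ε) ^ 2) :=
      hlog.comp (by fun_prop : Continuous fun ε : ℝ => ∑ x, μ x * (f x + ε) ^ 2)
    unfold dirichlet Ent
    fun_prop
  have ht := (hc.tendsto 0).mono_left (nhdsWithin_le_nhds (s := Set.Ioi (0 : ℝ)))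
  have h0 := ge_of_tendsto ht (b := 0) <| by
    filter_upwards [self_mem_nhdsWithin] with ε hε
    exact sub_nonneg.2
      (rho2tilde_mul_ent_le_of_pos hμ hM fun x => add_pos_of_nonneg_of_pos (hf x) hε)
  simpa using h0

lemma rho2tilde_le_one {μ : X → ℝ} {M : X → X → ℝ} {K : X → Y → ℝ} (hμ : IsDist μ)
    (hM : IsChannel M) (hrev : ∀ x x', μ x * M x x' = μ x' * M x' x) (hK : IsChannel K)
    (hadm : ∀ y, 0 < push μ K y)
    (hfact : ∀ x x', M x x' = ∑ y, adjoint μ K y x' * K x y) :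
    rho2tilde μ M ≤ 1 := by
  by_cases hex : ∃ f : X → ℝ, (∀ x, 0 < f x) ∧
      0 < Ent (fun u => u * Real.log u) μ (fun x => f x ^ 2)
  · obtain ⟨f, hf, hE⟩ := hex
    refine (rho2tilde_le hμ hM hf hE).trans ((div_le_one hE).2 ?_)
    have h := dirichlet_add_ent_le_ent hμ hM hrev hK hadm hfact fun x => (hf x).le
    have hg : ∀ y, 0 ≤ ∑ x, adjoint μ K y x * f x ^ 2 := fun y =>
      Finset.sum_nonneg fun x _ =>
        mul_nonneg ((adjoint_isDist hμ hK (hadm y)).1 x) (sq_nonneg _)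
    have h2 := ent_sq_nonneg (push_isDist hμ hK)
      fun y => Real.sqrt_nonneg (∑ x, adjoint μ K y x * f x ^ 2)
    simp_rw [Real.sq_sqrt (hg _)] at h2
    linarith
  · have he : rho2tilde μ M = 0 := by
      unfold rho2tilde
      convert Real.sInf_empty
      refine Set.eq_empty_iff_forall_notMem.2 ?_
      rintro r ⟨f, hf, hE, -⟩
      exact hex ⟨f, hf, hE⟩
    rw [he]
    exact zero_le_one

lemma fDiv_eq_ent {Φ : ℝ → ℝ} {μ ν : X → ℝ} (hμ : ∀ x, 0 < μ x) (hν : ∑ x, ν x = 1) :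
    fDiv Φ ν μ = Ent Φ μ (fun x => ν x / μ x) := by
  unfold fDiv Ent
  simp_rw [mul_div_cancel₀ _ (hμ _).ne', hν]

lemma push_div_push {Y : Type} {μ ν : X → ℝ} (hμ : ∀ x, 0 < μ x) (K : X → Y → ℝ) (y : Y) :
    push ν K y / push μ K y = ∑ x, adjoint μ K y x * (ν x / μ x) := by
  conv_lhs => rw [push, Finset.sum_div]
  refine Finset.sum_congr rfl fun x _ => ?_
  have := (hμ x).ne'
  unfold adjoint
  field_simp

/-- Theorem: for every channel `K` such that `(μ,K)` is admissible and the reversible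
pair `(μ,M)` factors through `K`, the relative-entropy SDPI constant satisfies
`η(μ,K) ≤ 1 − ρ̃₂(μ,M)`. -/
theorem statement18 {X Y : Type} [Fintype X] [Fintype Y] [Nonempty X] [Nonempty Y]
    (μ : X → ℝ) (hμ : IsPosDist μ)
    (M : X → X → ℝ) (hM : IsChannel M)
    (hrev : ∀ x x', μ x * M x x' = μ x' * M x' x)
    (K : X → Y → ℝ) (hK : IsChannel K) (hadm : ∀ y, 0 < push μ K y)
    (hfact : ∀ x x', M x x' = ∑ y, adjoint μ K y x' * K x y) :
    eta (fun u => u * Real.log u) μ K ≤ 1 - rho2tilde μ M := by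
  have hd : IsDist μ := ⟨fun x => (hμ.1 x).le, hμ.2⟩
  have h1 := rho2tilde_le_one hd hM hrev hK hadm hfact
  refine Real.sSup_le ?_ (sub_nonneg.2 h1)
  rintro r ⟨ν, hν, -, rfl⟩
  have hsq : ∀ x, Real.sqrt (ν x / μ x) ^ 2 = ν x / μ x := fun x =>
    Real.sq_sqrt (div_nonneg (hν.1 x) (hμ.1 x).le)
  have hf : ∀ x, 0 ≤ Real.sqrt (ν x / μ x) := fun x => Real.sqrt_nonneg _
  have hA := dirichlet_add_ent_le_ent hd hM hrev hK hadm hfact hf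
  have hB := rho2tilde_mul_ent_le hd hM hf
  have hC := ent_sq_nonneg hd hf
  simp_rw [hsq] at hA hB hC
  rw [fDiv_eq_ent hadm (push_isDist hν hK).2, fDiv_eq_ent hμ.1 hν.2]
  simp_rw [push_div_push hμ.1]
  refine div_le_of_le_mul₀ hC (sub_nonneg.2 h1) ?_
  linarith

end SDPI
end
end
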